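/- Let (A, B) be an n×n bimatrix game in which all entries of A and B are positive, and let C be the 2n×2n block matrix C = [[0, A],[Bᵀ, 0]]. If the set of Nash equilibria of (A, B) has cardinality at least N, then the set of Nash equilibria of the symmetric 2n×2n game (C, Cᵀ) has cardinality at least N². In particular, if (A, B) has more than 2ⁿ Nash equilibria, then (C, Cᵀ) has more than (2ⁿ)² = 2²ⁿ Nash equilibria. -/

import Mathlib

open Matrix BigOperators

/-- The `n × n` payoff matrix of the paper, with `1`-based indices `i+1, j+1`
for `i j : Fin n`: entry `2 p^{i+j}` above the diagonal, `p^{2i}` on the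
diagonal, `0` below it. -/
noncomputable def gameA (p : ℝ) (n : ℕ) : Matrix (Fin n) (Fin n) ℝ :=
  fun i j =>
    if (i : ℕ) < (j : ℕ) then 2 * p ^ (((i : ℕ) + 1) + ((j : ℕ) + 1))
    else if (i : ℕ) = (j : ℕ) then p ^ (2 * ((i : ℕ) + 1))
    else 0

/-- A mixed strategy: nonnegative components summing to `1`. -/
def IsMixed {I : Type*} [Fintype I] (y : I → ℝ) : Prop :=
  (∀ i, 0 ≤ y i) ∧ ∑ i, y i = 1

/-- `(x, y)` is a Nash equilibrium of the bimatrix game `(A, B)`. -/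
def IsNash {I J : Type*} [Fintype I] [Fintype J]
    (A B : Matrix I J ℝ) (x : I → ℝ) (y : J → ℝ) : Prop :=
  IsMixed x ∧ IsMixed y ∧
  (∀ x' : I → ℝ, IsMixed x' → x' ⬝ᵥ A.mulVec y ≤ x ⬝ᵥ A.mulVec y) ∧
  (∀ y' : J → ℝ, IsMixed y' → x ⬝ᵥ B.mulVec y' ≤ x ⬝ᵥ B.mulVec y)

theorem IsMixed.dotProduct_le {I : Type*} [Fintype I] {x v : I → ℝ} {w : ℝ}
    (hx : IsMixed x) (hv : ∀ i, v i ≤ w) : x ⬝ᵥ v ≤ w := by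
  calc x ⬝ᵥ v ≤ ∑ i, x i * w :=
        Finset.sum_le_sum fun i _ => mul_le_mul_of_nonneg_left (hv i) (hx.1 i)
    _ = w := by rw [← Finset.sum_mul, hx.2, one_mul]

theorem IsMixed.dotProduct_pos {I : Type*} [Fintype I] {x v : I → ℝ}
    (hx : IsMixed x) (hv : ∀ i, 0 < v i) : 0 < x ⬝ᵥ v := by
  have hnn : ∀ i ∈ Finset.univ, 0 ≤ x i := fun i _ => hx.1 i
  obtain ⟨i, hi, hxi⟩ := (Finset.sum_pos_iff_of_nonneg hnn).1 (hx.2 ▸ one_pos)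
  exact Finset.sum_pos' (fun i _ => mul_nonneg (hx.1 i) (hv i).le) ⟨i, hi, mul_pos hxi (hv i)⟩

theorem isMixed_single {I : Type*} [Fintype I] [DecidableEq I] (i : I) :
    IsMixed (Pi.single i (1 : ℝ)) := by
  refine ⟨fun j => ?_, by simp⟩
  by_cases h : j = i
  · subst h; simp
  · simp [h]

/-- A convex combination of mixed strategies on two disjoint index sets is mixed. -/
theorem IsMixed.sumElim {I J : Type*} [Fintype I] [Fintype J] {x : I → ℝ} {y : J → ℝ} {a b : ℝ}
    (hx : IsMixed x) (hy : IsMixed y) (ha : 0 ≤ a) (hb : 0 ≤ b) (hab : a + b = 1) :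
    IsMixed (Sum.elim (a • x) (b • y)) := by
  refine ⟨?_, ?_⟩
  · rintro (i | j)
    · exact mul_nonneg ha (hx.1 i)
    · exact mul_nonneg hb (hy.1 j)
  · simp [Fintype.sum_sum_type, ← Finset.mul_sum, hx.2, hy.2, hab]

theorem IsMixed.smul_inj {I : Type*} [Fintype I] {x x' : I → ℝ} {a a' : ℝ}
    (hx : IsMixed x) (hx' : IsMixed x') (ha : a ≠ 0) (h : a • x = a' • x') : x = x' := by
  have hs := congrArg (fun v : I → ℝ => ∑ i, v i) h
  simp only [Pi.smul_apply, smul_eq_mul, ← Finset.mul_sum, hx.2, hx'.2, mul_one] at hs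
  subst hs
  exact smul_right_injective _ ha h

section Nash

variable {I J : Type*} [Fintype I] [Fintype J] {A B : Matrix I J ℝ} {x : I → ℝ} {y : J → ℝ}

theorem IsNash.mulVec_le (h : IsNash A B x y) (i : I) : (A *ᵥ y) i ≤ x ⬝ᵥ A *ᵥ y := by
  classical
  simpa using h.2.2.1 _ (isMixed_single i)

theorem IsNash.transpose_mulVec_le (h : IsNash A B x y) (j : J) :
    (Bᵀ *ᵥ x) j ≤ x ⬝ᵥ B *ᵥ y := by
  classical
  have := h.2.2.2 _ (isMixed_single j)
  rwa [dotProduct_mulVec, dotProduct_single, mul_one, ← mulVec_transpose] at this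

theorem IsNash.of_le (hx : IsMixed x) (hy : IsMixed y) {u v : ℝ}
    (hu : ∀ i, (A *ᵥ y) i ≤ u) (hxu : x ⬝ᵥ A *ᵥ y = u)
    (hv : ∀ j, (Bᵀ *ᵥ x) j ≤ v) (hyv : y ⬝ᵥ Bᵀ *ᵥ x = v) : IsNash A B x y := by
  have comm (z : J → ℝ) : x ⬝ᵥ B *ᵥ z = z ⬝ᵥ Bᵀ *ᵥ x := by
    rw [dotProduct_mulVec, mulVec_transpose, dotProduct_comm]
  refine ⟨hx, hy, fun x' hx' => ?_, fun y' hy' => ?_⟩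
  · rw [hxu]; exact hx'.dotProduct_le hu
  · rw [comm, comm, hyv]; exact hy'.dotProduct_le hv

theorem IsMixed.dotProduct_mulVec_pos (hx : IsMixed x) (hy : IsMixed y)
    (hA : ∀ i j, 0 < A i j) : 0 < x ⬝ᵥ A *ᵥ y :=
  hx.dotProduct_pos fun i => by
    rw [mulVec, dotProduct_comm]; exact hy.dotProduct_pos (hA i)

/-- Two equilibria of `(A, B)` combine to an equilibrium of the symmetric block game, provided the
weights make each player indifferent between the two blocks. -/
theorem IsNash.fromBlocks {x' : I → ℝ} {y' : J → ℝ} (h : IsNash A B x y) (h' : IsNash A B x' y')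
    {a b c d : ℝ} (ha : 0 ≤ a) (hb : 0 ≤ b) (hab : a + b = 1)
    (hc : 0 ≤ c) (hd : 0 ≤ d) (hcd : c + d = 1)
    (hrow : d * (x ⬝ᵥ A *ᵥ y) = c * (x' ⬝ᵥ B *ᵥ y'))
    (hcol : b * (x' ⬝ᵥ A *ᵥ y') = a * (x ⬝ᵥ B *ᵥ y)) :
    IsNash (Matrix.fromBlocks 0 A Bᵀ 0) (Matrix.fromBlocks 0 A Bᵀ 0)ᵀ
      (Sum.elim (a • x) (b • y')) (Sum.elim (c • x') (d • y)) := by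
  have comm (x : I → ℝ) (y : J → ℝ) : y ⬝ᵥ Bᵀ *ᵥ x = x ⬝ᵥ B *ᵥ y := by
    rw [dotProduct_mulVec x, mulVec_transpose, dotProduct_comm]
  refine IsNash.of_le (h.1.sumElim h'.2.1 ha hb hab) (h'.1.sumElim h.2.1 hc hd hcd)
    (u := d * (x ⬝ᵥ A *ᵥ y)) (v := b * (x' ⬝ᵥ A *ᵥ y')) ?_ ?_ ?_ ?_
  · rintro (i | j)
    · simpa [fromBlocks_mulVec, mulVec_smul] using
        mul_le_mul_of_nonneg_left (h.mulVec_le i) hd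
    · rw [hrow]
      simpa [fromBlocks_mulVec, mulVec_smul] using
        mul_le_mul_of_nonneg_left (h'.transpose_mulVec_le j) hc
  · simp only [fromBlocks_mulVec, sumElim_dotProduct_sumElim, Sum.elim_comp_inl,
      Sum.elim_comp_inr, mulVec_smul, zero_mulVec, smul_zero, zero_add, add_zero, smul_dotProduct,
      dotProduct_smul, smul_eq_mul, comm]
    linear_combination (-b) * hrow + d * (x ⬝ᵥ A *ᵥ y) * hab
  · rw [transpose_transpose]
    rintro (i | j)
    · simpa [fromBlocks_mulVec, mulVec_smul] using
        mul_le_mul_of_nonneg_left (h'.mulVec_le i) hb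
    · rw [hcol]
      simpa [fromBlocks_mulVec, mulVec_smul] using
        mul_le_mul_of_nonneg_left (h.transpose_mulVec_le j) ha
  · rw [transpose_transpose]
    simp only [fromBlocks_mulVec, sumElim_dotProduct_sumElim, Sum.elim_comp_inl,
      Sum.elim_comp_inr, mulVec_smul, zero_mulVec, smul_zero, zero_add, add_zero, smul_dotProduct,
      dotProduct_smul, smul_eq_mul, comm]
    linear_combination (-d) * hcol + b * (x' ⬝ᵥ A *ᵥ y') * hcd

theorem exists_pos_weights {u v : ℝ} (hu : 0 < u) (hv : 0 < v) :
    ∃ a b : ℝ, 0 < a ∧ 0 < b ∧ a + b = 1 ∧ b * u = a * v := by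
  refine ⟨u / (u + v), v / (u + v), by positivity, by positivity, ?_, ?_⟩ <;> field_simp

theorem encard_isNash_sq_le (hA : ∀ i j, 0 < A i j) (hB : ∀ i j, 0 < B i j) :
    {q : (I → ℝ) × (J → ℝ) | IsNash A B q.1 q.2}.encard ^ 2 ≤
      {q : ((I ⊕ J) → ℝ) × ((I ⊕ J) → ℝ) |
        IsNash (Matrix.fromBlocks 0 A Bᵀ 0) (Matrix.fromBlocks 0 A Bᵀ 0)ᵀ q.1 q.2}.encard := by
  set S := {q : (I → ℝ) × (J → ℝ) | IsNash A B q.1 q.2}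
  have key : ∀ s : S ×ˢ S, ∃ a b c d : ℝ, 0 < a ∧ 0 < b ∧ 0 < c ∧ 0 < d ∧
      IsNash (Matrix.fromBlocks 0 A Bᵀ 0) (Matrix.fromBlocks 0 A Bᵀ 0)ᵀ
        (Sum.elim (a • s.1.1.1) (b • s.1.2.2)) (Sum.elim (c • s.1.2.1) (d • s.1.1.2)) := by
    rintro ⟨⟨⟨x, y⟩, ⟨x', y'⟩⟩, h, h'⟩
    replace h : IsNash A B x y := h
    replace h' : IsNash A B x' y' := h'
    obtain ⟨a, b, ha, hb, hab, hcol⟩ := exists_pos_weights (h'.1.dotProduct_mulVec_pos h'.2.1 hA)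
      (h.1.dotProduct_mulVec_pos h.2.1 hB)
    obtain ⟨c, d, hc, hd, hcd, hrow⟩ := exists_pos_weights (h.1.dotProduct_mulVec_pos h.2.1 hA)
      (h'.1.dotProduct_mulVec_pos h'.2.1 hB)
    exact ⟨a, b, c, d, ha, hb, hc, hd,
      h.fromBlocks h' ha.le hb.le hab hc.le hd.le hcd hrow hcol⟩
  choose a b c d ha hb hc hd hN using key
  rw [sq, ← Set.encard_prod]
  refine Function.Embedding.encard_le ⟨fun s => ⟨(_, _), hN s⟩, ?_⟩
  rintro s t hst
  obtain ⟨hst₁, hst₂⟩ := Prod.ext_iff.1 (Subtype.ext_iff.1 hst)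
  have h1 : a s • s.1.1.1 = a t • t.1.1.1 := congrArg (· ∘ Sum.inl) hst₁
  have h2 : b s • s.1.2.2 = b t • t.1.2.2 := congrArg (· ∘ Sum.inr) hst₁
  have h3 : c s • s.1.2.1 = c t • t.1.2.1 := congrArg (· ∘ Sum.inl) hst₂
  have h4 : d s • s.1.1.2 = d t • t.1.1.2 := congrArg (· ∘ Sum.inr) hst₂
  have hs1 : IsNash A B s.1.1.1 s.1.1.2 := s.2.1
  have hs2 : IsNash A B s.1.2.1 s.1.2.2 := s.2.2
  have ht1 : IsNash A B t.1.1.1 t.1.1.2 := t.2.1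
  have ht2 : IsNash A B t.1.2.1 t.1.2.2 := t.2.2
  exact Subtype.ext <| Prod.ext
    (Prod.ext (hs1.1.smul_inj ht1.1 (ha s).ne' h1) (hs1.2.1.smul_inj ht1.2.1 (hd s).ne' h4))
    (Prod.ext (hs2.1.smul_inj ht2.1 (hc s).ne' h3) (hs2.2.1.smul_inj ht2.2.1 (hb s).ne' h2))

end Nash

theorem stmt11 (n : ℕ) (A B : Matrix (Fin n) (Fin n) ℝ)
    (hA : ∀ i j, 0 < A i j) (hB : ∀ i j, 0 < B i j) :
    (∀ N : ℕ,
      (N : ℕ∞) ≤ {q : (Fin n → ℝ) × (Fin n → ℝ) | IsNash A B q.1 q.2}.encard →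
      ((N : ℕ∞)) ^ 2 ≤
        {q : ((Fin n ⊕ Fin n) → ℝ) × ((Fin n ⊕ Fin n) → ℝ) |
          IsNash (Matrix.fromBlocks 0 A Bᵀ 0) (Matrix.fromBlocks 0 A Bᵀ 0)ᵀ
            q.1 q.2}.encard) ∧
    (((2 : ℕ∞)) ^ n < {q : (Fin n → ℝ) × (Fin n → ℝ) | IsNash A B q.1 q.2}.encard →
      ((2 : ℕ∞)) ^ (2 * n) <
        {q : ((Fin n ⊕ Fin n) → ℝ) × ((Fin n ⊕ Fin n) → ℝ) |
          IsNash (Matrix.fromBlocks 0 A Bᵀ 0) (Matrix.fromBlocks 0 A Bᵀ 0)ᵀ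
            q.1 q.2}.encard) := by
  have key := encard_isNash_sq_le hA hB
  refine ⟨fun N hN => (pow_le_pow_left' hN 2).trans key, fun h => ?_⟩
  have h1 := pow_le_pow_left' (Order.add_one_le_of_lt h) 2
  refine lt_of_lt_of_le ?_ (h1.trans key)
  have h2 : 2 ^ (2 * n) < (2 ^ n + 1) ^ 2 := by
    rw [mul_comm, pow_mul]
    exact Nat.pow_lt_pow_left (Nat.lt_succ_self _) two_ne_zero
  exact_mod_cast h2
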